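/- Let (X,μ) and (Y,ν) be two σ-finite measure spaces and f : X → ℝ⁺, g : Y → ℝ⁺ measurable functions such that f* and g* are continuous and ‖f‖_{L¹(μ)} = ‖g‖_{L¹(ν)} < ∞. If ∫₀ᵗ f*(s) ds ≤ ∫₀ᵗ λ_g(s) ds holds for every t > 0, then for every r > 0, ∫₀ʳ g*(s) ds ≤ ∫₀ʳ λ_f(s) ds. -/

import Mathlib

open MeasureTheory ENNReal

/-- The distribution function `λ_f(s) = μ({x : |f(x)| > s})`. -/
noncomputable def distFn {α : Type*} [MeasurableSpace α] (μ : Measure α) (f : α → ℝ)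
    (s : ℝ) : ℝ≥0∞ :=
  μ {x | s < |f x|}

/-- The nonincreasing rearrangement `f*(t) = inf{s > 0 : λ_f(s) ≤ t}` (with value `∞` if no
such `s` exists). -/
noncomputable def rearr {α : Type*} [MeasurableSpace α] (μ : Measure α) (f : α → ℝ)
    (t : ℝ) : ℝ≥0∞ :=
  sInf (ENNReal.ofReal '' {s : ℝ | 0 < s ∧ distFn μ f s ≤ ENNReal.ofReal t})

lemma volume_Ioi_inter_ofReal_lt (a : ℝ≥0∞) :
    volume (Set.Ioi (0 : ℝ) ∩ {s : ℝ | ENNReal.ofReal s < a}) = a := by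
  rcases eq_or_ne a ⊤ with rfl | ha
  · simp
  · have : Set.Ioi (0 : ℝ) ∩ {s : ℝ | ENNReal.ofReal s < a} = Set.Ioo 0 a.toReal := by
      ext s
      simp only [Set.mem_inter_iff, Set.mem_Ioi, Set.mem_ofPred_eq, Set.mem_Ioo]
      exact and_congr_right fun hs => ENNReal.ofReal_lt_iff_lt_toReal hs.le ha
    rw [this, Real.volume_Ioo, sub_zero, ENNReal.ofReal_toReal ha]

lemma volume_Ioo_inter_ofReal_lt (r : ℝ) (a : ℝ≥0∞) :
    volume (Set.Ioo (0 : ℝ) r ∩ {s : ℝ | ENNReal.ofReal s < a}) = min a (ENNReal.ofReal r) := by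
  rw [← volume_Ioi_inter_ofReal_lt (min a (ENNReal.ofReal r))]
  congr 1
  ext s
  simp only [Set.mem_inter_iff, Set.mem_Ioi, Set.mem_ofPred_eq, Set.mem_Ioo, lt_min_iff]
  constructor
  · rintro ⟨⟨h0, hr⟩, ha⟩
    exact ⟨h0, ha, (ENNReal.ofReal_lt_ofReal_iff (h0.trans hr)).2 hr⟩
  · rintro ⟨h0, ha, hr⟩
    exact ⟨⟨h0, (ENNReal.ofReal_lt_ofReal_iff_of_nonneg h0.le).1 hr⟩, ha⟩

/-- Tonelli for a pair of mutually inverse (in the generalized sense) functions. -/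
lemma setLIntegral_eq_of_generalized_inverse {A B : ℝ → ℝ≥0∞} (hB : Measurable B)
    (hAB : ∀ t s : ℝ, 0 < t → 0 < s → (ENNReal.ofReal s < A t ↔ ENNReal.ofReal t < B s))
    {S : Set ℝ} (hS : MeasurableSet S) (hS0 : S ⊆ Set.Ioi 0) :
    ∫⁻ t in S, A t = ∫⁻ s in Set.Ioi 0, volume (S ∩ {t : ℝ | ENNReal.ofReal t < B s}) := by
  have hm : MeasurableSet {p : ℝ × ℝ | ENNReal.ofReal p.1 < B p.2} :=
    measurableSet_lt (ENNReal.measurable_ofReal.comp measurable_fst) (hB.comp measurable_snd)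
  calc ∫⁻ t in S, A t
      = ∫⁻ t in S, ∫⁻ s in Set.Ioi 0,
          {p : ℝ × ℝ | ENNReal.ofReal p.1 < B p.2}.indicator 1 (t, s) := by
        refine setLIntegral_congr_fun hS fun t ht => ?_
        have hmt : MeasurableSet {s : ℝ | ENNReal.ofReal t < B s} :=
          measurableSet_lt measurable_const hB
        have : (fun s => {p : ℝ × ℝ | ENNReal.ofReal p.1 < B p.2}.indicator
            (1 : ℝ × ℝ → ℝ≥0∞) (t, s)) = {s : ℝ | ENNReal.ofReal t < B s}.indicator 1 := rfl
        simp only [this]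
        rw [lintegral_indicator_one hmt, Measure.restrict_apply hmt, Set.inter_comm]
        nth_rw 1 [← volume_Ioi_inter_ofReal_lt (A t)]
        congr 1
        ext s
        exact and_congr_right fun hs => hAB t s (hS0 ht) hs
    _ = ∫⁻ s in Set.Ioi 0, ∫⁻ t in S,
          {p : ℝ × ℝ | ENNReal.ofReal p.1 < B p.2}.indicator 1 (t, s) :=
        lintegral_lintegral_swap
          ((measurable_const.indicator hm : Measurable
            ({p : ℝ × ℝ | ENNReal.ofReal p.1 < B p.2}.indicator 1)).aemeasurable)
    _ = _ := by
        refine lintegral_congr fun s => ?_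
        have hms : MeasurableSet {t : ℝ | ENNReal.ofReal t < B s} :=
          measurableSet_lt ENNReal.measurable_ofReal measurable_const
        have : (fun t => {p : ℝ × ℝ | ENNReal.ofReal p.1 < B p.2}.indicator
            (1 : ℝ × ℝ → ℝ≥0∞) (t, s)) = {t : ℝ | ENNReal.ofReal t < B s}.indicator 1 := rfl
        simp only [this]
        rw [lintegral_indicator_one hms, Measure.restrict_apply hms, Set.inter_comm]

section Rearrangement

variable {α : Type*} [MeasurableSpace α] (μ : Measure α) (f : α → ℝ)

lemma distFn_antitone : Antitone (distFn μ f) := fun _ _ h =>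
  measure_mono fun _ hx => lt_of_le_of_lt h hx

lemma rearr_antitone : Antitone (rearr μ f) := fun _ _ h =>
  sInf_le_sInf (Set.image_mono fun _ hs => ⟨hs.1, hs.2.trans (ENNReal.ofReal_le_ofReal h)⟩)

lemma distFn_le_of_forall_gt {s : ℝ} {c : ℝ≥0∞} (h : ∀ s' > s, distFn μ f s' ≤ c) :
    distFn μ f s ≤ c := by
  obtain ⟨u, hu, hus, hul⟩ := exists_seq_strictAnti_tendsto s
  have hU : {x | s < |f x|} = ⋃ n, {x | u n < |f x|} := by
    ext x
    simp only [Set.mem_ofPred_eq, Set.mem_iUnion]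
    exact ⟨fun hx => (hul.eventually_lt_const hx).exists, fun ⟨n, hn⟩ => (hus n).trans hn⟩
  have hmono : Monotone fun n => {x | u n < |f x|} := fun m n hmn x hx =>
    lt_of_le_of_lt (hu.antitone hmn) hx
  rw [distFn, hU, hmono.measure_iUnion]
  exact iSup_le fun n => h _ (hus n)

lemma ofReal_lt_rearr_iff {t s : ℝ} (hs : 0 < s) :
    ENNReal.ofReal s < rearr μ f t ↔ ENNReal.ofReal t < distFn μ f s := by
  rw [← not_le, ← not_le, not_iff_not]
  constructor
  · intro h
    refine distFn_le_of_forall_gt μ f fun s' hs' => ?_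
    have : rearr μ f t < ENNReal.ofReal s' :=
      h.trans_lt ((ENNReal.ofReal_lt_ofReal_iff_of_nonneg hs.le).2 hs')
    obtain ⟨_, ⟨v, hv, rfl⟩, hvs⟩ := sInf_lt_iff.1 this
    exact (distFn_antitone μ f
      ((ENNReal.ofReal_lt_ofReal_iff_of_nonneg hv.1.le).1 hvs).le).trans hv.2
  · intro h
    exact sInf_le ⟨s, ⟨hs, h⟩, rfl⟩

lemma setLIntegral_Ioo_rearr (r : ℝ) :
    ∫⁻ t in Set.Ioo 0 r, rearr μ f t =
      ∫⁻ s in Set.Ioi 0, min (distFn μ f s) (ENNReal.ofReal r) := by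
  rw [setLIntegral_eq_of_generalized_inverse (distFn_antitone μ f).measurable
    (fun t s _ hs => ofReal_lt_rearr_iff μ f hs) measurableSet_Ioo fun _ hx => hx.1]
  simp only [volume_Ioo_inter_ofReal_lt]

lemma setLIntegral_Ioo_distFn (r : ℝ) :
    ∫⁻ s in Set.Ioo 0 r, distFn μ f s =
      ∫⁻ t in Set.Ioi 0, min (rearr μ f t) (ENNReal.ofReal r) := by
  rw [setLIntegral_eq_of_generalized_inverse (rearr_antitone μ f).measurable
    (fun s t hs _ => (ofReal_lt_rearr_iff μ f hs).symm) measurableSet_Ioo fun _ hx => hx.1]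
  simp only [volume_Ioo_inter_ofReal_lt]

lemma setLIntegral_Ioi_distFn_eq_rearr :
    ∫⁻ s in Set.Ioi 0, distFn μ f s = ∫⁻ t in Set.Ioi 0, rearr μ f t := by
  rw [setLIntegral_eq_of_generalized_inverse (rearr_antitone μ f).measurable
    (fun s t hs _ => (ofReal_lt_rearr_iff μ f hs).symm) measurableSet_Ioi subset_rfl]
  simp only [volume_Ioi_inter_ofReal_lt]

variable {f}

lemma setLIntegral_Ioi_distFn (hfm : Measurable f) (hf0 : ∀ x, 0 ≤ f x) :
    ∫⁻ s in Set.Ioi 0, distFn μ f s = ∫⁻ x, ENNReal.ofReal (f x) ∂μ := by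
  rw [lintegral_eq_lintegral_meas_lt μ (Filter.Eventually.of_forall hf0) hfm.aemeasurable]
  simp only [distFn, abs_of_nonneg (hf0 _)]

lemma distFn_lt_top (hfm : Measurable f) (hf0 : ∀ x, 0 ≤ f x)
    (hfin : ∫⁻ x, ENNReal.ofReal (f x) ∂μ < ⊤) {r : ℝ} (hr : 0 < r) : distFn μ f r < ⊤ := by
  refine lt_of_le_of_lt (measure_mono fun x hx => ?_)
    ((meas_ge_le_lintegral_div hfm.ennreal_ofReal.aemeasurable
      (ENNReal.ofReal_pos.2 hr).ne' ENNReal.ofReal_ne_top).trans_lt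
      (ENNReal.div_lt_top hfin.ne (ENNReal.ofReal_pos.2 hr).ne'))
  rw [Set.mem_ofPred_eq, abs_of_nonneg (hf0 x)] at hx
  exact ENNReal.ofReal_le_ofReal hx.le

end Rearrangement

lemma setLIntegral_Ioi_zero_eq_add (h : ℝ → ℝ≥0∞) {t : ℝ} (ht : 0 ≤ t) :
    ∫⁻ s in Set.Ioi 0, h s = (∫⁻ s in Set.Ioo 0 t, h s) + ∫⁻ s in Set.Ioi t, h s := by
  rw [← Set.Ioc_union_Ioi_eq_Ioi ht, lintegral_union measurableSet_Ioi
    (Set.Ioc_disjoint_Ioi le_rfl), setLIntegral_congr Ioo_ae_eq_Ioc]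

/-- If `f*` and `g*` are continuous, `‖f‖₁ = ‖g‖₁ < ∞`, and
`∫₀ᵗ f*(s) ds ≤ ∫₀ᵗ λ_g(s) ds` for every `t > 0`, then
`∫₀ʳ g*(s) ds ≤ ∫₀ʳ λ_f(s) ds` for every `r > 0`. -/
theorem rearr_lambda_symmetric {X Y : Type*} [MeasurableSpace X] [MeasurableSpace Y]
    (μ : Measure X) (ν : Measure Y) [SigmaFinite μ] [SigmaFinite ν]
    (f : X → ℝ) (g : Y → ℝ) (hfm : Measurable f) (hgm : Measurable g)
    (hf0 : ∀ x, 0 ≤ f x) (hg0 : ∀ y, 0 ≤ g y)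
    (hfc : ContinuousOn (rearr μ f) (Set.Ioi 0))
    (hgc : ContinuousOn (rearr ν g) (Set.Ioi 0))
    (heq : ∫⁻ x, ENNReal.ofReal (f x) ∂μ = ∫⁻ y, ENNReal.ofReal (g y) ∂ν)
    (hfin : ∫⁻ x, ENNReal.ofReal (f x) ∂μ < ⊤)
    (hHLP : ∀ t : ℝ, 0 < t →
      ∫⁻ s in Set.Ioo 0 t, rearr μ f s ≤ ∫⁻ s in Set.Ioo 0 t, distFn ν g s) :
    ∀ r : ℝ, 0 < r →
      ∫⁻ s in Set.Ioo 0 r, rearr ν g s ≤ ∫⁻ s in Set.Ioo 0 r, distFn μ f s := by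
  intro r hr
  rw [setLIntegral_Ioo_rearr, setLIntegral_Ioo_distFn]
  set t := (distFn μ f r).toReal with ht_def
  have ht : 0 ≤ t := ENNReal.toReal_nonneg
  have htr : ENNReal.ofReal t = distFn μ f r :=
    ENNReal.ofReal_toReal (distFn_lt_top μ hfm hf0 hfin hr).ne
  have hhead : ∫⁻ s in Set.Ioo 0 t, rearr μ f s ≤ ∫⁻ s in Set.Ioo 0 t, distFn ν g s := by
    rcases ht.eq_or_lt with h | h
    · simp [← h]
    · exact hHLP t h
  have hF : ∫⁻ s in Set.Ioi 0, rearr μ f s = ∫⁻ x, ENNReal.ofReal (f x) ∂μ := by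
    rw [← setLIntegral_Ioi_distFn_eq_rearr, setLIntegral_Ioi_distFn μ hfm hf0]
  have hG := setLIntegral_Ioi_distFn ν hgm hg0
  rw [← heq, ← hF] at hG
  have htail : ∫⁻ s in Set.Ioi t, distFn ν g s ≤ ∫⁻ s in Set.Ioi t, rearr μ f s := by
    have hsplit := hG
    rw [setLIntegral_Ioi_zero_eq_add _ ht, setLIntegral_Ioi_zero_eq_add _ ht] at hsplit
    have hne : ∫⁻ s in Set.Ioo 0 t, rearr μ f s ≠ ⊤ :=
      ne_top_of_le_ne_top (hF ▸ hfin.ne)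
        (lintegral_mono_set (Set.Ioo_subset_Ioi_self))
    refine (ENNReal.add_le_add_iff_left hne).1 ?_
    rw [← hsplit]
    gcongr
  rw [setLIntegral_Ioi_zero_eq_add _ ht, setLIntegral_Ioi_zero_eq_add _ ht]
  refine add_le_add (setLIntegral_mono' measurableSet_Ioo fun s hs => ?_) ?_
  · have : ENNReal.ofReal r < rearr μ f s := by
      rw [ofReal_lt_rearr_iff μ f hr, ← htr]
      exact (ENNReal.ofReal_lt_ofReal_iff_of_nonneg hs.1.le).2 hs.2
    rw [min_eq_right this.le]
    exact min_le_right _ _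
  · calc ∫⁻ s in Set.Ioi t, min (distFn ν g s) (ENNReal.ofReal r)
        ≤ ∫⁻ s in Set.Ioi t, distFn ν g s := lintegral_mono fun s => min_le_left _ _
      _ ≤ ∫⁻ s in Set.Ioi t, rearr μ f s := htail
      _ ≤ ∫⁻ s in Set.Ioi t, min (rearr μ f s) (ENNReal.ofReal r) := by
        refine setLIntegral_mono' measurableSet_Ioi fun s hs => le_min le_rfl ?_
        rw [← not_lt, ofReal_lt_rearr_iff μ f hr, ← htr, not_lt]
        exact ENNReal.ofReal_le_ofReal (le_of_lt hs)
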